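/- arXiv:2408.16385 — 2 statements merged into one kernel-verified Lean document; each statement's English description precedes it below -/
import Mathlib

section
/- Let δ : [0,∞) → [0,1) be measurable, let X be a càdlàg path with no positive jumps, let x̄ ≥ max(X_0, 0), and let (V⁺, K⁺) be a tax-reflection pair for (X, δ, x̄). Define the left versions K_0 = 0, K_t = K⁺_{t−} for t > 0, V_0 = V⁺_0 − K⁺_0, and V_t = V⁺_t − ΔK⁺_t for t > 0. Then the running supremum of X + K with initial maximum level x̄ coincides at every time with that of X + K⁺, and V_t = X_t + K_t − ∫_{(0,t]} δ(V_s) d(overline{X+K})_s for all t ≥ 0, where overline{X+K} is the running supremum of X+K with initial maximum level x̄. -/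
open MeasureTheory Set Filter Function

noncomputable section

/-- Running supremum of a path over `[0, t]`. -/
def runSSup (Z : ℝ → ℝ) (t : ℝ) : ℝ := sSup (Z '' Set.Icc 0 t)

/-- Running supremum of a path with initial maximum level `xbar`. -/
def runSup (xbar : ℝ) (Z : ℝ → ℝ) (t : ℝ) : ℝ := max xbar (runSSup Z t)

/-- Skorokhod regulator at 0. -/
def Psi (Y : ℝ → ℝ) (t : ℝ) : ℝ := max 0 (-(sInf (Y '' Set.Icc 0 t)))

/-- Reflection of a path at 0 from below. -/
def Phi (Y : ℝ → ℝ) (t : ℝ) : ℝ := Y t + Psi Y t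

/-- A path, viewed on `[0,∞)`, is càdlàg: right-continuous at every `t ≥ 0` and
with left limits at every `t > 0`. -/
def Cadlag (Z : ℝ → ℝ) : Prop :=
  (∀ t : ℝ, 0 ≤ t → ContinuousWithinAt Z (Set.Ici t) t) ∧
  (∀ t : ℝ, 0 < t → ∃ l : ℝ, Filter.Tendsto Z (nhdsWithin t (Set.Iio t)) (nhds l))

/-- A càdlàg path has no positive jumps if `ΔZ_t = Z_t - Z_{t-} ≤ 0` for all `t > 0`. -/
def NoPosJumps (Z : ℝ → ℝ) : Prop :=
  ∀ t : ℝ, 0 < t → Z t ≤ Function.leftLim Z t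

/-- Lebesgue–Stieltjes measure of an increasing right-continuous path on `[0,∞)`,
without the atom at `0`. -/
def lsMeasureAux (f : ℝ → ℝ) : Measure ℝ := by
  classical
  exact if h : Monotone (fun t => f (max t 0)) ∧
      ∀ x : ℝ, ContinuousWithinAt (fun t => f (max t 0)) (Set.Ici x) x then
    StieltjesFunction.measure ⟨fun t => f (max t 0), h.1, h.2⟩
  else 0

/-- Lebesgue–Stieltjes measure of an increasing right-continuous path on `[0,∞)`,
with an atom of mass `f 0` at `0`. -/
def lsMeasure (f : ℝ → ℝ) : Measure ℝ :=
  lsMeasureAux f + (ENNReal.ofReal (f 0)) • Measure.dirac 0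

/-- `(V, K)` is a tax-reflection pair for `(X, δ, xbar)`. -/
def IsTaxReflectionPair (δ : ℝ → ℝ) (X : ℝ → ℝ) (xbar : ℝ) (V K : ℝ → ℝ) : Prop :=
  Cadlag V ∧ Cadlag K ∧
  (∀ t : ℝ, 0 ≤ t → 0 ≤ V t) ∧
  MonotoneOn K (Set.Ici 0) ∧
  (∀ t : ℝ, 0 ≤ t →
    V t = X t + K t -
      ∫ s in Set.Ioc (0:ℝ) t, δ (V s)
        ∂(lsMeasure (runSup xbar (fun s => X s + K s)))) ∧
  lsMeasure K {t : ℝ | 0 ≤ t ∧ 0 < V t} = 0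

/-- A solution of the ODE `y' = 1 - δ(y)`, `y(0) = y₀`, on `[0,∞)`. -/
def IsFlow (δ : ℝ → ℝ) (y₀ : ℝ) (y : ℝ → ℝ) : Prop :=
  ContinuousOn y (Set.Ici 0) ∧
  ∀ t : ℝ, 0 ≤ t → y t = y₀ + ∫ s in (0:ℝ)..t, (1 - δ (y s))

/-- `δ` admits a unique flow: for every `y₀ ≥ 0` the ODE `y' = 1 - δ(y)`, `y(0) = y₀`
has exactly one continuous solution on `[0,∞)`. -/
def AdmitsUniqueFlow (δ : ℝ → ℝ) : Prop :=
  ∀ y₀ : ℝ, 0 ≤ y₀ →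
    (∃ y : ℝ → ℝ, IsFlow δ y₀ y) ∧
    ∀ y z : ℝ → ℝ, IsFlow δ y₀ y → IsFlow δ y₀ z → ∀ t : ℝ, 0 ≤ t → y t = z t

open Topology

lemma Cadlag.bddAbove_image {Z : ℝ → ℝ} (hZ : Cadlag Z) (t : ℝ) :
    BddAbove (Z '' Set.Icc 0 t) := by
  refine isCompact_Icc.induction_on (p := fun s => BddAbove (Z '' s)) (by simp)
    (fun s u hsu hu => hu.mono (image_mono hsu))
    (fun s u hs hu => by rw [image_union]; exact hs.union hu) ?_
  intro x hx
  have hright : ∃ b, ∀ᶠ u in 𝓝[≥] x, Z u ≤ b :=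
    Filter.Tendsto.isBoundedUnder_le (hZ.1 x hx.1)
  obtain ⟨b, hb⟩ := hright
  rcases hx.1.eq_or_lt with h0 | h0
  · refine ⟨{u | Z u ≤ b}, ?_, b, ?_⟩
    · refine nhdsWithin_mono x (fun u hu => ?_) hb
      exact h0 ▸ hu.1
    · rintro _ ⟨u, hu, rfl⟩
      exact hu
  · obtain ⟨l, hl⟩ := hZ.2 x h0
    have hleft : ∃ c, ∀ᶠ u in 𝓝[<] x, Z u ≤ c := Filter.Tendsto.isBoundedUnder_le hl
    obtain ⟨c, hc⟩ := hleft
    refine ⟨{u | Z u ≤ max b c}, ?_, max b c, ?_⟩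
    · apply mem_nhdsWithin_of_mem_nhds
      rw [← nhdsLT_sup_nhdsGE x]
      exact ⟨hc.mono fun u hu => le_max_of_le_right hu,
        hb.mono fun u hu => le_max_of_le_left hu⟩
    · rintro _ ⟨u, hu, rfl⟩
      exact hu

lemma Cadlag.add {Y Z : ℝ → ℝ} (hY : Cadlag Y) (hZ : Cadlag Z) :
    Cadlag (fun s => Y s + Z s) := by
  refine ⟨fun t ht => (hY.1 t ht).add (hZ.1 t ht), fun t ht => ?_⟩
  obtain ⟨l, hl⟩ := hY.2 t ht
  obtain ⟨m, hm⟩ := hZ.2 t ht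
  exact ⟨l + m, hl.add hm⟩

lemma runSup_le {xbar : ℝ} {Z : ℝ → ℝ} {t c : ℝ} (ht : 0 ≤ t) (hx : xbar ≤ c)
    (h : ∀ s, 0 ≤ s → s ≤ t → Z s ≤ c) : runSup xbar Z t ≤ c := by
  refine max_le hx (csSup_le ((nonempty_Icc.2 ht).image Z) ?_)
  rintro _ ⟨s, hs, rfl⟩
  exact h s hs.1 hs.2

lemma le_runSup {xbar : ℝ} {Z : ℝ → ℝ} {s t : ℝ} (hZ : BddAbove (Z '' Set.Icc 0 t))
    (hs : 0 ≤ s) (hst : s ≤ t) : Z s ≤ runSup xbar Z t :=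
  le_max_of_le_right (le_csSup hZ ⟨s, ⟨hs, hst⟩, rfl⟩)

lemma Cadlag.monotoneOn_runSup {Z : ℝ → ℝ} (hZ : Cadlag Z) (xbar : ℝ) :
    MonotoneOn (runSup xbar Z) (Set.Ici 0) := fun _ ha b _ hab =>
  runSup_le ha (le_max_left _ _)
    fun _ hs hsa => le_runSup (hZ.bddAbove_image b) hs (hsa.trans hab)

lemma Cadlag.continuousWithinAt_runSup {Z : ℝ → ℝ} (hZ : Cadlag Z) (xbar : ℝ) {a : ℝ}
    (ha : 0 ≤ a) : ContinuousWithinAt (runSup xbar Z) (Set.Ici a) a := by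
  refine tendsto_order.2 ⟨fun c hc => ?_, fun c hc => ?_⟩
  · filter_upwards [self_mem_nhdsWithin] with u hu
    exact hc.trans_le (hZ.monotoneOn_runSup xbar ha (ha.trans hu) hu)
  · obtain ⟨d, hd, hdc⟩ := exists_between hc
    have hZa : Z a < d := (le_runSup (hZ.bddAbove_image a) ha le_rfl).trans_lt hd
    obtain ⟨u, hau, hu⟩ := mem_nhdsGE_iff_exists_Ico_subset.1
      ((hZ.1 a ha).eventually (gt_mem_nhds hZa))
    filter_upwards [Ico_mem_nhdsGE hau] with v hv
    refine (runSup_le (ha.trans hv.1) ((le_max_left _ _).trans hd.le) ?_).trans_lt hdc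
    intro s hs hsv
    rcases le_total s a with h | h
    · exact (le_runSup (hZ.bddAbove_image a) hs h).trans hd.le
    · exact le_of_lt (hu ⟨h, hsv.trans_lt hv.2⟩)

/-- The Stieltjes function of an increasing right-continuous path on `[0,∞)`, extended to be
constant on `(-∞,0]`. -/
def pathStieltjes (f : ℝ → ℝ) (hm : MonotoneOn f (Set.Ici 0))
    (hc : ∀ t, 0 ≤ t → ContinuousWithinAt f (Set.Ici t) t) : StieltjesFunction ℝ where
  toFun t := f (max t 0)
  mono' a b h := hm (mem_Ici.2 (le_max_right a 0)) (mem_Ici.2 (le_max_right b 0))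
    (max_le_max_right 0 h)
  right_continuous' x := by
    refine ContinuousWithinAt.comp (t := Set.Ici (max x 0)) (hc _ (le_max_right x 0))
      (by fun_prop) ?_
    exact fun y hy => mem_Ici.2 (max_le_max_right 0 (mem_Ici.1 hy))

lemma lsMeasureAux_eq {f : ℝ → ℝ} (hm : MonotoneOn f (Set.Ici 0))
    (hc : ∀ t, 0 ≤ t → ContinuousWithinAt f (Set.Ici t) t) :
    lsMeasureAux f = (pathStieltjes f hm hc).measure := by
  unfold lsMeasureAux
  exact dif_pos ⟨(pathStieltjes f hm hc).mono', (pathStieltjes f hm hc).right_continuous'⟩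

lemma lsMeasure_Ioc {f : ℝ → ℝ} (hm : MonotoneOn f (Set.Ici 0))
    (hc : ∀ t, 0 ≤ t → ContinuousWithinAt f (Set.Ici t) t) {t : ℝ} (ht : 0 ≤ t) :
    lsMeasure f (Set.Ioc 0 t) = ENNReal.ofReal (f t - f 0) := by
  rw [lsMeasure, lsMeasureAux_eq hm hc]
  simp only [Measure.add_apply, Measure.smul_apply, StieltjesFunction.measure_Ioc]
  simp [pathStieltjes, ht]

lemma leftLim_pathStieltjes {f : ℝ → ℝ} (hm : MonotoneOn f (Set.Ici 0))
    (hc : ∀ t, 0 ≤ t → ContinuousWithinAt f (Set.Ici t) t) {t : ℝ} (ht : 0 < t) :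
    leftLim (pathStieltjes f hm hc) t = leftLim f t := by
  symm
  apply leftLim_eq_of_tendsto
  refine ((pathStieltjes f hm hc).mono.tendsto_leftLim t).congr' ?_
  filter_upwards [mem_nhdsWithin_of_mem_nhds (lt_mem_nhds ht)] with u hu
  change f (max u 0) = f u
  rw [max_eq_left (le_of_lt hu)]

lemma tendsto_leftLim_of_monotoneOn {f : ℝ → ℝ} (hm : MonotoneOn f (Set.Ici 0))
    (hc : ∀ t, 0 ≤ t → ContinuousWithinAt f (Set.Ici t) t) {t : ℝ} (ht : 0 < t) :
    Tendsto f (𝓝[<] t) (𝓝 (leftLim f t)) := by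
  rw [← leftLim_pathStieltjes hm hc ht]
  refine ((pathStieltjes f hm hc).mono.tendsto_leftLim t).congr' ?_
  filter_upwards [mem_nhdsWithin_of_mem_nhds (lt_mem_nhds ht)] with u hu
  change f (max u 0) = f u
  rw [max_eq_left (le_of_lt hu)]

lemma le_leftLim_of_monotoneOn {f : ℝ → ℝ} (hm : MonotoneOn f (Set.Ici 0))
    (hc : ∀ t, 0 ≤ t → ContinuousWithinAt f (Set.Ici t) t) {s t : ℝ} (hs : 0 ≤ s)
    (hst : s < t) : f s ≤ leftLim f t := by
  refine ge_of_tendsto (tendsto_leftLim_of_monotoneOn hm hc (hs.trans_lt hst)) ?_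
  filter_upwards [Ioo_mem_nhdsLT hst] with u hu
  exact hm hs (hs.trans hu.1.le) hu.1.le

lemma leftLim_le_of_forall_lt {f : ℝ → ℝ} (hm : MonotoneOn f (Set.Ici 0))
    (hc : ∀ t, 0 ≤ t → ContinuousWithinAt f (Set.Ici t) t) {t c : ℝ} (ht : 0 < t)
    (h : ∀ s, 0 ≤ s → s < t → f s ≤ c) : leftLim f t ≤ c := by
  refine le_of_tendsto (tendsto_leftLim_of_monotoneOn hm hc ht) ?_
  filter_upwards [Ioo_mem_nhdsLT ht] with u hu
  exact h u hu.1.le hu.2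

lemma lsMeasure_singleton {f : ℝ → ℝ} (hm : MonotoneOn f (Set.Ici 0))
    (hc : ∀ t, 0 ≤ t → ContinuousWithinAt f (Set.Ici t) t) {t : ℝ} (ht : 0 < t) :
    lsMeasure f {t} = ENNReal.ofReal (f t - leftLim f t) := by
  rw [lsMeasure, lsMeasureAux_eq hm hc]
  simp only [Measure.add_apply, Measure.smul_apply, StieltjesFunction.measure_singleton,
    leftLim_pathStieltjes hm hc ht]
  simp [pathStieltjes, ht.le, ht.ne]

lemma lsMeasure_congr {f g : ℝ → ℝ} (h : ∀ t, 0 ≤ t → f t = g t) :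
    lsMeasure f = lsMeasure g := by
  have : (fun t => f (max t 0)) = fun t => g (max t 0) :=
    funext fun t => h _ (le_max_right _ _)
  have haux : lsMeasureAux f = lsMeasureAux g := by
    classical
    exact congrArg (fun u : ℝ → ℝ =>
      if h : Monotone u ∧ ∀ x : ℝ, ContinuousWithinAt u (Set.Ici x) x then
        StieltjesFunction.measure ⟨u, h.1, h.2⟩
      else 0) this
  rw [lsMeasure, lsMeasure, haux, h 0 le_rfl]

lemma setIntegral_lt_measureReal {μ : Measure ℝ} {s : Set ℝ} (hs : MeasurableSet s)
    {f : ℝ → ℝ} (hf : ∀ x ∈ s, f x < 1) (hpos : 0 < μ.real s) :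
    ∫ x in s, f x ∂μ < μ.real s := by
  have hfin : μ s ≠ ⊤ := fun h => by simp [measureReal_def, h] at hpos
  by_cases hi : IntegrableOn f s μ
  · have h1 : IntegrableOn (fun _ => (1 : ℝ)) s μ := integrableOn_const hfin
    have : 0 < ∫ x in s, (1 - f x) ∂μ := by
      rw [setIntegral_pos_iff_support_of_nonneg_ae]
      · have : support (fun x => 1 - f x) ∩ s = s :=
          inter_eq_right.2 fun x hx => (sub_pos.2 (hf x hx)).ne'
        rw [this]
        exact (ENNReal.toReal_pos_iff.1 hpos).1
      · filter_upwards [ae_restrict_mem hs] with x hx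
        exact (sub_pos.2 (hf x hx)).le
      · exact h1.sub hi
    rw [integral_sub h1 hi] at this
    simpa using this
  · rwa [integral_undef hi]

/-- The reflected path vanishes at the jump times of the regulator. -/
lemma IsTaxReflectionPair.eq_zero_of_jump {δ X V K : ℝ → ℝ} {xbar s : ℝ}
    (h : IsTaxReflectionPair δ X xbar V K) (hs : 0 < s) (hjump : leftLim K s < K s) :
    V s = 0 := by
  obtain ⟨-, hK, hV, hmono, -, hcomp⟩ := h
  by_contra hne
  have hpos : 0 < V s := lt_of_le_of_ne (hV s hs.le) (Ne.symm hne)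
  have h0 : lsMeasure K {s} = 0 :=
    measure_mono_null (t := {t | 0 ≤ t ∧ 0 < V t}) (singleton_subset_iff.2 ⟨hs.le, hpos⟩) hcomp
  rw [lsMeasure_singleton hmono hK.1 hs, ENNReal.ofReal_eq_zero] at h0
  linarith

lemma IsTaxReflectionPair.initial_le {δ X V K : ℝ → ℝ} {xbar : ℝ}
    (h : IsTaxReflectionPair δ X xbar V K) (hx : max (X 0) 0 ≤ xbar) :
    X 0 + K 0 ≤ xbar := by
  obtain ⟨-, hK, hV, hmono, heq, hcomp⟩ := h
  have h0 := heq 0 le_rfl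
  simp only [Ioc_self, Measure.restrict_empty, integral_zero_measure, sub_zero] at h0
  rcases le_or_gt (K 0) 0 with hK0 | hK0
  · linarith [le_max_left (X 0) 0]
  · have hV0 : V 0 ≤ 0 := by
      by_contra! hpos
      have : lsMeasure K {(0 : ℝ)} = 0 :=
        measure_mono_null (t := {t | 0 ≤ t ∧ 0 < V t}) (singleton_subset_iff.2 ⟨le_rfl, hpos⟩) hcomp
      simp [lsMeasure, hK0.not_ge] at this
    linarith [le_max_right (X 0) 0]

/-- The running supremum does not jump at the jump times of the regulator. -/
lemma IsTaxReflectionPair.runSup_le_leftLim {δ X V K : ℝ → ℝ} {xbar s : ℝ}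
    (h : IsTaxReflectionPair δ X xbar V K) (hδ : ∀ y, 0 ≤ y → δ y ∈ Set.Ico (0 : ℝ) 1)
    (hX : Cadlag X) (hx : 0 ≤ xbar) (hs : 0 < s) (hjump : leftLim K s < K s) :
    runSup xbar (fun s => X s + K s) s ≤ leftLim (runSup xbar (fun s => X s + K s)) s := by
  have hVs := h.eq_zero_of_jump hs hjump
  obtain ⟨-, hK, hV, -, heq, -⟩ := h
  have heqs := heq s hs.le
  have hZ := hX.add hK
  set M := runSup xbar (fun s => X s + K s) with hM
  have hm : MonotoneOn M (Set.Ici 0) := hZ.monotoneOn_runSup xbar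
  have hc : ∀ t, 0 ≤ t → ContinuousWithinAt M (Set.Ici t) t :=
    fun t ht => hZ.continuousWithinAt_runSup xbar ht
  have hM0 : M 0 ≤ leftLim M s := le_leftLim_of_monotoneOn hm hc le_rfl hs
  have hxM : xbar ≤ M 0 := le_max_left _ _
  by_contra! hlt
  have hreal : (lsMeasure M).real (Set.Ioc 0 s) = M s - M 0 := by
    rw [measureReal_def, lsMeasure_Ioc hm hc hs.le, ENNReal.toReal_ofReal (by linarith)]
  have hint := setIntegral_lt_measureReal (μ := lsMeasure M) (f := fun u => δ (V u))
    (measurableSet_Ioc (a := 0) (b := s))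
    (fun u hu => (hδ _ (hV u hu.1.le)).2) (by rw [hreal]; linarith)
  rw [hreal] at hint
  have : M s ≤ max (leftLim M s) (X s + K s) := by
    refine runSup_le hs.le (le_max_of_le_left (hxM.trans hM0)) fun r hr hrs => ?_
    rcases hrs.eq_or_lt with rfl | hrs
    · exact le_max_right _ _
    · exact le_max_of_le_left ((le_runSup (hZ.bddAbove_image r) hr le_rfl).trans
        (le_leftLim_of_monotoneOn hm hc hr hrs))
  rcases le_max_iff.1 this with h1 | h1 <;> linarith

/-- The jump times of an increasing right-continuous path are countable. -/
lemma countable_jumps {f : ℝ → ℝ} (hm : MonotoneOn f (Set.Ici 0))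
    (hc : ∀ t, 0 ≤ t → ContinuousWithinAt f (Set.Ici t) t) :
    {t : ℝ | 0 < t ∧ leftLim f t < f t}.Countable := by
  refine (pathStieltjes f hm hc).mono.countable_not_continuousAt.mono ?_
  intro t ht hcont
  have h1 := (pathStieltjes f hm hc).mono.continuousAt_iff_leftLim_eq_rightLim.1 hcont
  rw [(pathStieltjes f hm hc).rightLim_eq, leftLim_pathStieltjes hm hc ht.1] at h1
  have h2 : pathStieltjes f hm hc t = f t := congrArg f (max_eq_left ht.1.le)
  rw [h2] at h1
  exact ht.2.ne h1

/-- **The left version `(V, K)` of a tax-reflection pair satisfies equation (2.6).** -/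
theorem tax_reflection_left_version_equation
    (δ : ℝ → ℝ) (hδmeas : Measurable δ)
    (hδ01 : ∀ y : ℝ, 0 ≤ y → δ y ∈ Set.Ico (0:ℝ) 1)
    (X : ℝ → ℝ) (hX : Cadlag X) (hXjumps : NoPosJumps X)
    (xbar : ℝ) (hxbar : max (X 0) 0 ≤ xbar)
    (Vp Kp : ℝ → ℝ) (hVK : IsTaxReflectionPair δ X xbar Vp Kp)
    (V K : ℝ → ℝ)
    (hK0 : K 0 = 0) (hKt : ∀ t : ℝ, 0 < t → K t = Function.leftLim Kp t)
    (hV0 : V 0 = Vp 0 - Kp 0)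
    (hVt : ∀ t : ℝ, 0 < t → V t = Vp t - (Kp t - Function.leftLim Kp t)) :
    (∀ t : ℝ, 0 ≤ t →
      runSup xbar (fun s => X s + K s) t = runSup xbar (fun s => X s + Kp s) t) ∧
    ∀ t : ℝ, 0 ≤ t →
      V t = X t + K t -
        ∫ s in Set.Ioc (0:ℝ) t, δ (V s)
          ∂(lsMeasure (runSup xbar (fun s => X s + K s))) := by
  obtain ⟨-, hKc, hVnn, hKmono, heq, -⟩ := id hVK
  have hxbar0 : 0 ≤ xbar := (le_max_right _ _).trans hxbar
  have hZ : Cadlag (fun s => X s + Kp s) := hX.add hKc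
  have hZ0 : X 0 + Kp 0 ≤ xbar := hVK.initial_le hxbar
  have hMm := hZ.monotoneOn_runSup xbar
  have hMc : ∀ t, 0 ≤ t → ContinuousWithinAt (runSup xbar (fun s => X s + Kp s)) (Set.Ici t) t :=
    fun t ht => hZ.continuousWithinAt_runSup xbar ht
  have hKle : ∀ t, 0 < t → K t ≤ Kp t := fun t ht => by
    rw [hKt t ht]
    exact leftLim_le_of_forall_lt hKmono hKc.1 ht
      fun s hs hst => hKmono hs ht.le hst.le
  have hle : ∀ s t, 0 ≤ s → s ≤ t →
      X s + K s ≤ runSup xbar (fun s => X s + Kp s) t := fun s t hs hst => by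
    rcases hs.eq_or_lt with rfl | hs0
    · rw [hK0, add_zero]
      exact ((le_max_left _ _).trans hxbar).trans (le_max_left _ _)
    · exact (add_le_add_right (hKle s hs0) (X s)).trans
        (le_runSup (Z := fun s => X s + Kp s) (hZ.bddAbove_image t) hs hst)
  have hbdd : ∀ t, BddAbove ((fun s => X s + K s) '' Set.Icc 0 t) := fun t =>
    ⟨_, by rintro _ ⟨s, hs, rfl⟩; exact hle s t hs.1 hs.2⟩
  have hlt : ∀ r t, 0 ≤ r → r < t → X r + Kp r ≤ runSup xbar (fun s => X s + K s) t := by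
    intro r t hr hrt
    have hlim : Tendsto (fun u => X u + Kp r) (𝓝[>] r) (𝓝 (X r + Kp r)) :=
      ((hX.1 r hr).mono_left (nhdsWithin_mono r Ioi_subset_Ici_self)).add_const _
    refine le_of_tendsto hlim ?_
    filter_upwards [Ioo_mem_nhdsGT hrt] with u hu
    have hu0 : 0 < u := hr.trans_lt hu.1
    have h1 : Kp r ≤ K u := by
      rw [hKt u hu0]
      exact le_leftLim_of_monotoneOn hKmono hKc.1 hr hu.1
    exact (add_le_add_right h1 (X u)).trans
      (le_runSup (Z := fun s => X s + K s) (hbdd t) hu0.le hu.2.le)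
  have hsup : ∀ t, 0 ≤ t →
      runSup xbar (fun s => X s + K s) t = runSup xbar (fun s => X s + Kp s) t := by
    intro t ht
    refine le_antisymm (runSup_le ht (le_max_left _ _) fun s hs hst => hle s t hs hst)
      (runSup_le ht (le_max_left _ _) fun s hs hst => ?_)
    rcases hst.lt_or_eq with hst | rfl
    · exact hlt s t hs hst
    rcases hs.eq_or_lt with rfl | hs0
    · exact hZ0.trans (le_max_left _ _)
    rcases (hKle s hs0).lt_or_eq with hj | hj
    · have hjump : leftLim Kp s < Kp s := hKt s hs0 ▸ hj
      refine ((le_runSup (hZ.bddAbove_image s) hs le_rfl).trans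
        (hVK.runSup_le_leftLim hδ01 hX hxbar0 hs0 hjump)).trans ?_
      exact leftLim_le_of_forall_lt hMm hMc hs0 fun r hr hrs =>
        runSup_le hr (le_max_left _ _) fun q hq hqr => hlt q s hq (hqr.trans_lt hrs)
    · rw [← hj]
      exact le_runSup (Z := fun s => X s + K s) (hbdd s) hs le_rfl
  refine ⟨hsup, fun t ht => ?_⟩
  have hint : ∫ s in Set.Ioc (0 : ℝ) t, δ (V s) ∂(lsMeasure (runSup xbar (fun s => X s + K s))) =
      ∫ s in Set.Ioc (0 : ℝ) t, δ (Vp s)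
        ∂(lsMeasure (runSup xbar (fun s => X s + Kp s))) := by
    rw [lsMeasure_congr hsup]
    have hnull : lsMeasure (runSup xbar (fun s => X s + Kp s))
        {t : ℝ | 0 < t ∧ leftLim Kp t < Kp t} = 0 := by
      rw [← biUnion_of_singleton {t : ℝ | 0 < t ∧ leftLim Kp t < Kp t},
        measure_biUnion_null_iff (countable_jumps hKmono hKc.1)]
      intro s hs
      rw [lsMeasure_singleton hMm hMc hs.1, ENNReal.ofReal_eq_zero, sub_nonpos]
      exact hVK.runSup_le_leftLim hδ01 hX hxbar0 hs.1 hs.2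
    refine integral_congr_ae ?_
    filter_upwards [ae_restrict_mem measurableSet_Ioc,
      ae_restrict_of_ae (measure_eq_zero_iff_ae_notMem.1 hnull)] with s hs hns
    have hge : Kp s ≤ leftLim Kp s := not_lt.1 fun h => hns ⟨hs.1, h⟩
    have heqK : leftLim Kp s = Kp s := le_antisymm (hKt s hs.1 ▸ hKle s hs.1) hge
    rw [hVt s hs.1, heqK, sub_self, sub_zero]
  rw [hint]
  have h1 := heq t ht
  rcases ht.eq_or_lt with rfl | ht0
  · rw [hV0, hK0]
    linarith
  · rw [hVt t ht0, hKt t ht0]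
    linarith

end
end

section
/- Let T > 0, γ ∈ [0,1), and let X : [0,T] → ℝ be a càdlàg function. Then the map K ↦ Ψ(X − γ S(X+K)), acting on the space of càdlàg functions K : [0,T] → ℝ equipped with the uniform metric, has exactly one fixed point; that is, there is exactly one càdlàg K : [0,T] → ℝ with K_t = max(0, −inf_{0≤s≤t}(X_s − γ·sup_{0≤u≤s}(X_u + K_u))) for all t ∈ [0,T]. -/
open MeasureTheory Set Filter Function

noncomputable section

/-- A function `Z : [0,T] → ℝ` (modelled on all of `ℝ`) is càdlàg on `[0,T]`. -/
def CadlagOn (T : ℝ) (Z : ℝ → ℝ) : Prop :=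
  (∀ t : ℝ, t ∈ Set.Ico (0:ℝ) T → ContinuousWithinAt Z (Set.Icc t T) t) ∧
  (∀ t : ℝ, t ∈ Set.Ioc (0:ℝ) T →
    ∃ l : ℝ, Filter.Tendsto Z (nhdsWithin t (Set.Ico 0 t)) (nhds l))

theorem CadlagOn.add {T : ℝ} {Z W : ℝ → ℝ} (hZ : CadlagOn T Z) (hW : CadlagOn T W) :
    CadlagOn T (fun t => Z t + W t) := by
  refine ⟨fun t ht => (hZ.1 t ht).add (hW.1 t ht), fun t ht => ?_⟩
  obtain ⟨a, ha⟩ := hZ.2 t ht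
  obtain ⟨b, hb⟩ := hW.2 t ht
  exact ⟨a + b, ha.add hb⟩

theorem CadlagOn.const_mul {T : ℝ} {Z : ℝ → ℝ} (hZ : CadlagOn T Z) (c : ℝ) :
    CadlagOn T (fun t => c * Z t) := by
  refine ⟨fun t ht => (hZ.1 t ht).const_mul c, fun t ht => ?_⟩
  obtain ⟨a, ha⟩ := hZ.2 t ht
  exact ⟨c * a, ha.const_mul c⟩

theorem CadlagOn.exists_abs_le {T : ℝ} {Z : ℝ → ℝ} (hZ : CadlagOn T Z) :
    ∃ M, ∀ t ∈ Icc 0 T, |Z t| ≤ M := by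
  have of_tendsto {s : Set ℝ} {t l : ℝ} (h : Tendsto Z (nhdsWithin t s) (nhds l)) :
      ∀ᶠ x in nhdsWithin t s, |Z x| ≤ |l| + 1 :=
    (h.abs.eventually_lt_const (lt_add_one _)).mono fun _ hx => hx.le
  refine isCompact_Icc.induction_on (p := fun s => ∃ M, ∀ t ∈ s, |Z t| ≤ M) ⟨0, by simp⟩
    (fun s t hst ⟨M, hM⟩ => ⟨M, fun x hx => hM x (hst hx)⟩) ?_ ?_
  · rintro s t ⟨M, hM⟩ ⟨N, hN⟩
    refine ⟨max M N, ?_⟩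
    rintro x (hx | hx)
    · exact (hM x hx).trans (le_max_left _ _)
    · exact (hN x hx).trans (le_max_right _ _)
  · intro t ht
    have hleft : ∃ M, ∀ᶠ x in nhdsWithin t (Ico 0 t), |Z x| ≤ M := by
      rcases ht.1.eq_or_lt with rfl | h0
      · exact ⟨0, by simp⟩
      · obtain ⟨l, hl⟩ := hZ.2 t ⟨h0, ht.2⟩
        exact ⟨_, of_tendsto hl⟩
    have hright : ∃ M, ∀ᶠ x in nhdsWithin t (Icc t T), |Z x| ≤ M := by
      rcases ht.2.eq_or_lt with rfl | h1
      · exact ⟨|Z t|, by simp⟩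
      · exact ⟨_, of_tendsto (hZ.1 t ⟨ht.1, h1⟩)⟩
    obtain ⟨M, hM⟩ := hleft
    obtain ⟨N, hN⟩ := hright
    refine ⟨{x | |Z x| ≤ max M N}, ?_, max M N, fun x hx => hx⟩
    rw [← Ico_union_Icc_eq_Icc ht.1 ht.2, nhdsWithin_union]
    exact ⟨hM.mono fun x hx => hx.trans (le_max_left _ _),
      hN.mono fun x hx => hx.trans (le_max_right _ _)⟩

theorem CadlagOn.bddAbove_image {T t : ℝ} {Z : ℝ → ℝ} (hZ : CadlagOn T Z) (ht : t ≤ T) :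
    BddAbove (Z '' Icc 0 t) := by
  obtain ⟨M, hM⟩ := hZ.exists_abs_le
  refine ⟨M, ?_⟩
  rintro _ ⟨s, hs, rfl⟩
  exact (le_abs_self _).trans (hM s ⟨hs.1, hs.2.trans ht⟩)

theorem CadlagOn.le_runSSup {T s t : ℝ} {Z : ℝ → ℝ} (hZ : CadlagOn T Z) (ht : t ≤ T)
    (hs : s ∈ Icc 0 t) : Z s ≤ runSSup Z t :=
  le_csSup (hZ.bddAbove_image ht) (mem_image_of_mem Z hs)

theorem runSSup_le {t c : ℝ} {Z : ℝ → ℝ} (ht : 0 ≤ t) (h : ∀ s ∈ Icc 0 t, Z s ≤ c) :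
    runSSup Z t ≤ c := by
  refine csSup_le ((nonempty_Icc.2 ht).image Z) ?_
  rintro _ ⟨s, hs, rfl⟩
  exact h s hs

theorem abs_runSSup_sub_le {T t c : ℝ} {Z W : ℝ → ℝ} (hZ : CadlagOn T Z) (hW : CadlagOn T W)
    (ht : t ∈ Icc 0 T) (h : ∀ s ∈ Icc 0 T, |Z s - W s| ≤ c) :
    |runSSup Z t - runSSup W t| ≤ c := by
  rw [abs_sub_le_iff]
  constructor
  · rw [sub_le_iff_le_add]
    refine runSSup_le ht.1 fun s hs => ?_
    linarith [hW.le_runSSup ht.2 hs, (abs_sub_le_iff.1 (h s ⟨hs.1, hs.2.trans ht.2⟩)).1]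
  · rw [sub_le_iff_le_add]
    refine runSSup_le ht.1 fun s hs => ?_
    linarith [hZ.le_runSSup ht.2 hs, (abs_sub_le_iff.1 (h s ⟨hs.1, hs.2.trans ht.2⟩)).2]

theorem CadlagOn.monotoneOn_runSSup {T : ℝ} {Z : ℝ → ℝ} (hZ : CadlagOn T Z) :
    MonotoneOn (runSSup Z) (Icc 0 T) := fun _ hs _ ht hst =>
  runSSup_le hs.1 fun _ hu => hZ.le_runSSup ht.2 ⟨hu.1, hu.2.trans hst⟩

theorem cadlagOn_of_monotoneOn {T : ℝ} {Z : ℝ → ℝ} (hm : MonotoneOn Z (Icc 0 T))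
    (hr : ∀ t ∈ Ico 0 T, ContinuousWithinAt Z (Icc t T) t) : CadlagOn T Z := by
  refine ⟨hr, fun t ht => ⟨sSup (Z '' Ico 0 t), ?_⟩⟩
  have hsub {s : ℝ} (hs : s ∈ Ico 0 t) : s ∈ Icc 0 T := ⟨hs.1, hs.2.le.trans ht.2⟩
  have hbdd : BddAbove (Z '' Ico 0 t) := by
    refine ⟨Z t, ?_⟩
    rintro _ ⟨s, hs, rfl⟩
    exact hm (hsub hs) ⟨ht.1.le, ht.2⟩ hs.2.le
  refine tendsto_order.2 ⟨fun a ha => ?_, fun a ha => ?_⟩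
  · obtain ⟨_, ⟨s, hs, rfl⟩, has⟩ := exists_lt_of_lt_csSup ((nonempty_Ico.2 ht.1).image Z) ha
    filter_upwards [self_mem_nhdsWithin, nhdsWithin_le_nhds (Ioi_mem_nhds hs.2)] with u hu hsu
    exact has.trans_le (hm (hsub hs) (hsub hu) (le_of_lt hsu))
  · filter_upwards [self_mem_nhdsWithin] with u hu
    exact (le_csSup hbdd (mem_image_of_mem Z hu)).trans_lt ha

theorem CadlagOn.runSSup {T : ℝ} {Z : ℝ → ℝ} (hZ : CadlagOn T Z) :
    CadlagOn T (runSSup Z) := by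
  refine cadlagOn_of_monotoneOn hZ.monotoneOn_runSSup fun t ht => ?_
  have hmem : t ∈ Icc 0 T := ⟨ht.1, ht.2.le⟩
  refine tendsto_order.2 ⟨fun a ha => ?_, fun a ha => ?_⟩
  · filter_upwards [self_mem_nhdsWithin] with u hu
    exact ha.trans_le (hZ.monotoneOn_runSSup hmem ⟨ht.1.trans hu.1, hu.2⟩ hu.1)
  · obtain ⟨b, hb, hba⟩ := exists_between ha
    have hZt : Z t < b := (hZ.le_runSSup ht.2.le ⟨ht.1, le_rfl⟩).trans_lt hb
    have hev := (hZ.1 t ht).eventually_lt_const hZt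
    rw [eventually_nhdsWithin_iff, Metric.eventually_nhds_iff] at hev
    obtain ⟨ε, hε, hev⟩ := hev
    filter_upwards [self_mem_nhdsWithin, nhdsWithin_le_nhds (Metric.ball_mem_nhds t hε)]
      with u hu hut
    refine (runSSup_le (ht.1.trans hu.1) fun s hs => ?_).trans_lt hba
    rcases le_total s t with hst | hts
    · exact (hZ.le_runSSup ht.2.le ⟨hs.1, hst⟩).trans hb.le
    · refine (hev ?_ ⟨hts, hs.2.trans hu.2⟩).le
      rw [Metric.mem_ball, Real.dist_eq, abs_of_nonneg (sub_nonneg.2 hu.1)] at hut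
      rw [Real.dist_eq, abs_of_nonneg (sub_nonneg.2 hts)]
      linarith [hs.2]

theorem Psi_eq_max_runSSup (Y : ℝ → ℝ) (t : ℝ) :
    Psi Y t = max 0 (runSSup (fun s => -1 * Y s) t) := by
  have h : (fun s => -1 * Y s) '' Icc 0 t = -(Y '' Icc 0 t) := by
    rw [← image_neg_eq_neg, image_image]
    simp
  rw [Psi, runSSup, h, Real.sInf_def, neg_neg]

theorem CadlagOn.monotoneOn_Psi {T : ℝ} {Y : ℝ → ℝ} (hY : CadlagOn T Y) :
    MonotoneOn (Psi Y) (Icc 0 T) := fun s hs t ht hst => by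
  rw [Psi_eq_max_runSSup, Psi_eq_max_runSSup]
  exact max_le_max le_rfl ((hY.const_mul (-1)).monotoneOn_runSSup hs ht hst)

theorem CadlagOn.Psi {T : ℝ} {Y : ℝ → ℝ} (hY : CadlagOn T Y) : CadlagOn T (Psi Y) := by
  refine cadlagOn_of_monotoneOn hY.monotoneOn_Psi fun t ht => ?_
  simp only [funext (Psi_eq_max_runSSup Y)]
  exact continuousWithinAt_const.max ((hY.const_mul (-1)).runSSup.1 t ht)

theorem abs_Psi_sub_le {T t c : ℝ} {Y W : ℝ → ℝ} (hY : CadlagOn T Y) (hW : CadlagOn T W)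
    (ht : t ∈ Icc 0 T) (h : ∀ s ∈ Icc 0 T, |Y s - W s| ≤ c) :
    |Psi Y t - Psi W t| ≤ c := by
  rw [Psi_eq_max_runSSup, Psi_eq_max_runSSup, max_comm 0, max_comm 0]
  refine (abs_max_sub_max_le_abs _ _ _).trans ?_
  refine abs_runSSup_sub_le (hY.const_mul (-1)) (hW.const_mul (-1)) ht fun s hs => ?_
  rw [← mul_sub, abs_mul, abs_neg, abs_one, one_mul]
  exact h s hs

/-- The map `K ↦ Ψ(X − γ S(X + K))`. -/
def taxRegulator (γ : ℝ) (X K : ℝ → ℝ) : ℝ → ℝ :=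
  Psi (fun s => X s - γ * runSSup (fun u => X u + K u) s)

theorem CadlagOn.sub_mul_runSSup {T : ℝ} {X K : ℝ → ℝ} (hX : CadlagOn T X) (hK : CadlagOn T K)
    (γ : ℝ) : CadlagOn T (fun s => X s - γ * _root_.runSSup (fun u => X u + K u) s) := by
  simpa only [neg_mul, ← sub_eq_add_neg] using hX.add ((hX.add hK).runSSup.const_mul (-γ))

theorem CadlagOn.taxRegulator {T : ℝ} {X K : ℝ → ℝ} (hX : CadlagOn T X) (hK : CadlagOn T K)
    (γ : ℝ) : CadlagOn T (taxRegulator γ X K) :=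
  (hX.sub_mul_runSSup hK γ).Psi

theorem abs_taxRegulator_sub_le {T γ c : ℝ} {X K L : ℝ → ℝ} (hγ : 0 ≤ γ) (hX : CadlagOn T X)
    (hK : CadlagOn T K) (hL : CadlagOn T L) (h : ∀ s ∈ Icc 0 T, |K s - L s| ≤ c) :
    ∀ t ∈ Icc 0 T, |taxRegulator γ X K t - taxRegulator γ X L t| ≤ γ * c := fun t ht => by
  refine abs_Psi_sub_le (hX.sub_mul_runSSup hK γ) (hX.sub_mul_runSSup hL γ) ht fun s hs => ?_
  rw [sub_sub_sub_cancel_left, ← mul_sub, abs_mul, abs_of_nonneg hγ, abs_sub_comm]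
  refine mul_le_mul_of_nonneg_left (abs_runSSup_sub_le (hX.add hK) (hX.add hL) hs ?_) hγ
  simpa only [add_sub_add_left_eq_sub] using h

theorem exists_fixedPoint_taxRegulator {T γ : ℝ} {X : ℝ → ℝ} (hγ : γ ∈ Ico (0:ℝ) 1)
    (hX : CadlagOn T X) :
    ∃ K, CadlagOn T K ∧ ∀ t ∈ Icc 0 T, K t = taxRegulator γ X K t := by
  set k : ℕ → ℝ → ℝ := fun n => (taxRegulator γ X)^[n] 0
  have k_succ (n : ℕ) : k (n + 1) = taxRegulator γ X (k n) := iterate_succ_apply' _ _ _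
  have hk (n : ℕ) : CadlagOn T (k n) ∧ MonotoneOn (k n) (Icc 0 T) := by
    induction n with
    | zero =>
      have hm : MonotoneOn (k 0) (Icc 0 T) := fun _ _ _ _ _ => le_rfl
      exact ⟨cadlagOn_of_monotoneOn hm fun _ _ => continuousWithinAt_const, hm⟩
    | succ n ih =>
      rw [k_succ]
      exact ⟨hX.taxRegulator ih.1 γ, (hX.sub_mul_runSSup ih.1 γ).monotoneOn_Psi⟩
  obtain ⟨c, hc⟩ := (hk 1).1.exists_abs_le
  have hstep (n : ℕ) : ∀ t ∈ Icc 0 T, |k n t - k (n + 1) t| ≤ γ ^ n * c := by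
    induction n with
    | zero =>
      intro t ht
      have h0 : k 0 t = 0 := rfl
      rw [h0, zero_sub, abs_neg, pow_zero, one_mul]
      exact hc t ht
    | succ n ih =>
      rw [k_succ (n + 1)]
      nth_rewrite 1 [k_succ n]
      rw [pow_succ', mul_assoc]
      exact abs_taxRegulator_sub_le hγ.1 hX (hk n).1 (hk (n + 1)).1 ih
  have hdist {t : ℝ} (ht : t ∈ Icc 0 T) (n : ℕ) : dist (k n t) (k (n + 1) t) ≤ c * γ ^ n := by
    rw [Real.dist_eq, mul_comm]
    exact hstep n t ht
  have hlim (t : ℝ) : ∃ l, t ∈ Icc 0 T → Tendsto (fun n => k n t) atTop (nhds l) := by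
    by_cases ht : t ∈ Icc 0 T
    · obtain ⟨l, hl⟩ := cauchySeq_tendsto_of_complete
        (cauchySeq_of_le_geometric γ c hγ.2 (hdist ht))
      exact ⟨l, fun _ => hl⟩
    · exact ⟨0, fun h => absurd h ht⟩
  choose K hK using hlim
  have herr (n : ℕ) : ∀ t ∈ Icc 0 T, |k n t - K t| ≤ c * γ ^ n / (1 - γ) := fun t ht =>
    dist_le_of_le_geometric_of_tendsto γ c hγ.2 (hdist ht) (hK t ht) n
  have hzero : Tendsto (fun n : ℕ => c * γ ^ n / (1 - γ)) atTop (nhds 0) := by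
    simpa using ((tendsto_pow_atTop_nhds_zero_of_lt_one hγ.1 hγ.2).const_mul c).div_const (1 - γ)
  have hKm : MonotoneOn K (Icc 0 T) := fun s hs t ht hst =>
    le_of_tendsto_of_tendsto' (hK s hs) (hK t ht) fun n => (hk n).2 hs ht hst
  have hKc : CadlagOn T K := by
    refine cadlagOn_of_monotoneOn hKm fun t ht => ?_
    refine continuousWithinAt_of_locally_uniform_approx_of_continuousWithinAt
      (left_mem_Icc.2 ht.2.le) fun u hu => ?_
    obtain ⟨ε, hε, hεu⟩ := Metric.mem_uniformity_dist.1 hu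
    obtain ⟨n, hn⟩ := (hzero.eventually_lt_const hε).exists
    refine ⟨Icc t T, self_mem_nhdsWithin, k n, (hk n).1.1 t ht, fun y hy => hεu ?_⟩
    rw [dist_comm]
    exact (herr n y ⟨ht.1.trans hy.1, hy.2⟩).trans_lt hn
  refine ⟨K, hKc, fun t ht => tendsto_nhds_unique ((tendsto_add_atTop_iff_nat 1).2 (hK t ht)) ?_⟩
  refine tendsto_iff_dist_tendsto_zero.2 (squeeze_zero (fun _ => dist_nonneg) (fun n => ?_)
    (by simpa using hzero.const_mul γ))
  rw [k_succ, Real.dist_eq]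
  exact abs_taxRegulator_sub_le hγ.1 hX (hk n).1 hKc (herr n) t ht

theorem eqOn_of_fixedPoint_taxRegulator {T γ : ℝ} {X K L : ℝ → ℝ} (hγ : γ ∈ Ico (0:ℝ) 1)
    (hX : CadlagOn T X) (hK : CadlagOn T K) (hL : CadlagOn T L)
    (hKfix : ∀ t ∈ Icc 0 T, K t = taxRegulator γ X K t)
    (hLfix : ∀ t ∈ Icc 0 T, L t = taxRegulator γ X L t) : EqOn K L (Icc 0 T) := by
  obtain ⟨M, hM⟩ := hK.exists_abs_le
  obtain ⟨N, hN⟩ := hL.exists_abs_le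
  have h (n : ℕ) : ∀ t ∈ Icc 0 T, |K t - L t| ≤ γ ^ n * (M + N) := by
    induction n with
    | zero =>
      intro t ht
      rw [pow_zero, one_mul]
      exact (abs_sub _ _).trans (add_le_add (hM t ht) (hN t ht))
    | succ n ih =>
      intro t ht
      rw [hKfix t ht, hLfix t ht, pow_succ', mul_assoc]
      exact abs_taxRegulator_sub_le hγ.1 hX hK hL ih t ht
  intro t ht
  have hzero : Tendsto (fun n : ℕ => γ ^ n * (M + N)) atTop (nhds 0) := by
    simpa using (tendsto_pow_atTop_nhds_zero_of_lt_one hγ.1 hγ.2).mul_const (M + N)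
  exact sub_eq_zero.1 (abs_nonpos_iff.1 (ge_of_tendsto' hzero fun n => h n t ht))

/-- **Banach fixed point: the map `K ↦ Ψ(X − γ S(X+K))` on càdlàg functions on `[0,T]`
has exactly one fixed point.** -/
theorem fixed_point_on_finite_horizon
    (T γ : ℝ) (hT : 0 < T) (hγ : γ ∈ Set.Ico (0:ℝ) 1)
    (X : ℝ → ℝ) (hX : CadlagOn T X) :
    (∃ K : ℝ → ℝ, CadlagOn T K ∧ ∀ t ∈ Set.Icc (0:ℝ) T,
      K t = Psi (fun s => X s - γ * runSSup (fun u => X u + K u) s) t) ∧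
    ∀ K L : ℝ → ℝ, CadlagOn T K → CadlagOn T L →
      (∀ t ∈ Set.Icc (0:ℝ) T,
        K t = Psi (fun s => X s - γ * runSSup (fun u => X u + K u) s) t) →
      (∀ t ∈ Set.Icc (0:ℝ) T,
        L t = Psi (fun s => X s - γ * runSSup (fun u => X u + L u) s) t) →
      ∀ t ∈ Set.Icc (0:ℝ) T, K t = L t := by
  exact ⟨exists_fixedPoint_taxRegulator hγ hX, fun K L hK hL hKfix hLfix =>
    eqOn_of_fixedPoint_taxRegulator hγ hX hK hL hKfix hLfix⟩

end
end
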